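/- Let S ⊂ V(G) and n ∈ ℕ, n ≥ 1, be such that cl^n(S) = V(G) (so all boundaries b(cl^j(S)), j ≤ n−1, are nonempty). Then for every l ∈ ℕ with l ≥ 1, setting r = 2^l, and every f ∈ L₂(G): ‖f‖ ≤ 2r·(∏_{i=0}^{n−1} (2·D_i/K_i + 1))^{1/2} · (Σ_{v∈S} |f(v)|²)^{1/2} + 2^{4r−3}·(Σ_{j=0}^{n−1} (1/K_j)·∏_{i=j+1}^{n−1} (2·D_i/K_i + 1))^{r/2} · ‖L^{r/2} f‖, where ‖L^{r/2} f‖ = ⟨L^r f, f⟩^{1/2}. -/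

import Mathlib

open scoped BigOperators

variable {V : Type*}

noncomputable def lapl (G : SimpleGraph V) [DecidableRel G.Adj] [G.LocallyFinite]
    (f : V → ℂ) (v : V) : ℂ :=
  ∑ u ∈ G.neighborFinset v, (f v - f u)

noncomputable def l2norm (f : V → ℂ) : ℝ :=
  Real.sqrt (∑' v, ‖f v‖ ^ 2)

/-- `⟨L^r f, f⟩`, the Dirichlet form of the `r`-th power of the Laplacian. -/
noncomputable def dirichletPow (G : SimpleGraph V) [DecidableRel G.Adj] [G.LocallyFinite]
    (f : V → ℂ) (r : ℕ) : ℝ :=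
  (∑' v, (lapl G)^[r] f v * (starRingEnd ℂ) (f v)).re

def bdry (G : SimpleGraph V) (S : Set V) : Set V :=
  {v | v ∉ S ∧ ∃ u ∈ S, G.Adj u v}

def cl (G : SimpleGraph V) (S : Set V) : Set V := S ∪ bdry G S

noncomputable def Dm (G : SimpleGraph V) (S : Set V) (m : ℕ) : ℕ :=
  sSup ((fun v => {w | w ∈ bdry G ((cl G)^[m] S) ∧ G.Adj v w}.ncard) '' ((cl G)^[m] S))

noncomputable def Km (G : SimpleGraph V) (S : Set V) (m : ℕ) : ℕ :=
  sInf ((fun v => {w | w ∈ (cl G)^[m] S ∧ G.Adj v w}.ncard) '' bdry G ((cl G)^[m] S))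

section PairSums

variable (G : SimpleGraph V) [G.LocallyFinite]

theorem finite_setOf_of_imp_adj {P : V → V → Prop} (hP : ∀ v u, P v u → G.Adj v u) (v : V) :
    {u | P v u}.Finite :=
  (Set.toFinite (G.neighborSet v)).subset fun u hu => hP v u hu

theorem ncard_le_of_imp_adj {D : ℕ} (hD : ∀ v, G.degree v ≤ D) {P : V → V → Prop}
    (hP : ∀ v u, P v u → G.Adj v u) (v : V) : {u | P v u}.ncard ≤ D := by
  refine le_trans ?_ (hD v)
  rw [← G.card_neighborFinset_eq_degree, ← Set.ncard_coe_finset]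
  refine Set.ncard_le_ncard (fun u hu => ?_) (Finset.finite_toSet _)
  simpa using hP v u hu

theorem tsum_indicator_fst {P : V → V → Prop} (hP : ∀ v u, P v u → G.Adj v u) (g : V → ℝ) (v : V) :
    ∑' u, {p : V × V | P p.1 p.2}.indicator (fun p => g p.1) (v, u)
      = ({u | P v u}.ncard : ℝ) * g v := by
  classical
  have hfin := finite_setOf_of_imp_adj G hP v
  rw [tsum_eq_sum (s := hfin.toFinset)]
  · rw [Set.ncard_eq_toFinset_card _ hfin, ← nsmul_eq_mul, ← Finset.sum_const]
    refine Finset.sum_congr rfl fun u hu => ?_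
    have : P v u := by simpa using hu
    simp [Set.indicator, this]
  · intro u hu
    have : ¬ P v u := by simpa using hu
    simp [Set.indicator, this]

theorem summable_ncard_mul {D : ℕ} (hD : ∀ v, G.degree v ≤ D) {P : V → V → Prop}
    (hP : ∀ v u, P v u → G.Adj v u) {g : V → ℝ} (hg : Summable g) (hg0 : ∀ v, 0 ≤ g v) :
    Summable fun v => ({u | P v u}.ncard : ℝ) * g v := by
  refine Summable.of_nonneg_of_le (fun v => mul_nonneg (Nat.cast_nonneg _) (hg0 v)) (fun v => ?_)
    (hg.mul_left (D : ℝ))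
  exact mul_le_mul_of_nonneg_right (by exact_mod_cast ncard_le_of_imp_adj G hD hP v) (hg0 v)

theorem summable_indicator_fst {D : ℕ} (hD : ∀ v, G.degree v ≤ D) {P : V → V → Prop}
    (hP : ∀ v u, P v u → G.Adj v u) {g : V → ℝ} (hg : Summable g) (hg0 : ∀ v, 0 ≤ g v) :
    Summable ({p : V × V | P p.1 p.2}.indicator fun p => g p.1) := by
  refine (summable_prod_of_nonneg (fun p => Set.indicator_nonneg (fun q _ => hg0 q.1) p)).2 ⟨?_, ?_⟩
  · intro v
    refine summable_of_hasFiniteSupport ((finite_setOf_of_imp_adj G hP v).subset fun u hu => ?_)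
    by_contra h
    exact hu (Set.indicator_of_notMem (s := {p : V × V | P p.1 p.2}) h _)
  · simp_rw [tsum_indicator_fst G hP]
    exact summable_ncard_mul G hD hP hg hg0

theorem tsum_prod_indicator_fst {D : ℕ} (hD : ∀ v, G.degree v ≤ D) {P : V → V → Prop}
    (hP : ∀ v u, P v u → G.Adj v u) {g : V → ℝ} (hg : Summable g) (hg0 : ∀ v, 0 ≤ g v) :
    ∑' p : V × V, {p : V × V | P p.1 p.2}.indicator (fun p => g p.1) p
      = ∑' v, ({u | P v u}.ncard : ℝ) * g v := by
  rw [(summable_indicator_fst G hD hP hg hg0).tsum_prod]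
  simp_rw [tsum_indicator_fst G hP]

theorem summable_indicator_snd {D : ℕ} (hD : ∀ v, G.degree v ≤ D) {P : V → V → Prop}
    (hP : ∀ v u, P v u → G.Adj v u) {g : V → ℝ} (hg : Summable g) (hg0 : ∀ v, 0 ≤ g v) :
    Summable ({p : V × V | P p.1 p.2}.indicator fun p => g p.2) :=
  (Equiv.prodComm V V).summable_iff.1
    (summable_indicator_fst G hD (P := fun v u => P u v) (fun v u h => (hP u v h).symm) hg hg0)

theorem tsum_prod_indicator_snd {D : ℕ} (hD : ∀ v, G.degree v ≤ D) {P : V → V → Prop}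
    (hP : ∀ v u, P v u → G.Adj v u) {g : V → ℝ} (hg : Summable g) (hg0 : ∀ v, 0 ≤ g v) :
    ∑' p : V × V, {p : V × V | P p.1 p.2}.indicator (fun p => g p.2) p
      = ∑' u, ({v | P v u}.ncard : ℝ) * g u := by
  rw [← tsum_prod_indicator_fst G hD (P := fun v u => P u v) (fun v u h => (hP u v h).symm) hg hg0]
  exact ((Equiv.prodComm V V).tsum_eq _).symm

/-- The set of ordered pairs of adjacent vertices. -/
def adjPairs (G : SimpleGraph V) : Set (V × V) := {p | G.Adj p.1 p.2}

theorem sq_norm_sub_le (a b : ℂ) : ‖a - b‖ ^ 2 ≤ 2 * ‖a‖ ^ 2 + 2 * ‖b‖ ^ 2 := by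
  have h := norm_sub_le a b
  have h0 := norm_nonneg (a - b)
  nlinarith [sq_nonneg (‖a‖ - ‖b‖)]

theorem sq_norm_le_add_sub (a b : ℂ) : ‖a‖ ^ 2 ≤ 2 * ‖b‖ ^ 2 + 2 * ‖a - b‖ ^ 2 := by
  have h := norm_add_le b (a - b)
  rw [add_sub_cancel] at h
  have h0 := norm_nonneg a
  nlinarith [sq_nonneg (‖b‖ - ‖a - b‖)]

theorem summable_adjPairs_sq_sub {D : ℕ} (hD : ∀ v, G.degree v ≤ D) {f : V → ℂ}
    (hf : Summable fun v => ‖f v‖ ^ 2) :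
    Summable ((adjPairs G).indicator fun p => ‖f p.1 - f p.2‖ ^ 2) := by
  have h1 := summable_indicator_fst G hD (P := G.Adj) (fun _ _ h => h) hf (fun v => sq_nonneg _)
  have h2 := summable_indicator_snd G hD (P := G.Adj) (fun _ _ h => h) hf (fun v => sq_nonneg _)
  refine Summable.of_nonneg_of_le (fun p => Set.indicator_nonneg (fun q _ => sq_nonneg _) p)
    (fun p => ?_) ((h1.mul_left 2).add (h2.mul_left 2))
  by_cases hp : G.Adj p.1 p.2
  · simpa [adjPairs, Set.indicator, hp] using sq_norm_sub_le (f p.1) (f p.2)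
  · simp [adjPairs, Set.indicator, hp]

theorem tsum_indicator_adjPairs {E : Type*} [AddCommMonoid E] [TopologicalSpace E]
    (F : V × V → E) (v : V) :
    ∑' u, (adjPairs G).indicator F (v, u) = ∑ u ∈ G.neighborFinset v, F (v, u) := by
  rw [tsum_eq_sum (s := G.neighborFinset v)]
  · refine Finset.sum_congr rfl fun u hu => Set.indicator_of_mem ?_ _
    simpa [adjPairs] using hu
  · intro u hu
    refine Set.indicator_of_notMem ?_ _
    simpa [adjPairs] using hu

end PairSums

section Laplacian

variable (G : SimpleGraph V) [DecidableRel G.Adj] [G.LocallyFinite]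

theorem summable_sq_lapl {D : ℕ} (hD : ∀ v, G.degree v ≤ D) {f : V → ℂ}
    (hf : Summable fun v => ‖f v‖ ^ 2) : Summable fun v => ‖lapl G f v‖ ^ 2 := by
  have h := (summable_adjPairs_sq_sub G hD hf).prod.mul_left (D : ℝ)
  simp_rw [tsum_indicator_adjPairs] at h
  refine Summable.of_nonneg_of_le (fun v => sq_nonneg _) (fun v => ?_) h
  have h1 : ‖lapl G f v‖ ≤ ∑ u ∈ G.neighborFinset v, ‖f v - f u‖ := norm_sum_le _ _
  calc ‖lapl G f v‖ ^ 2 ≤ (∑ u ∈ G.neighborFinset v, ‖f v - f u‖) ^ 2 := by gcongr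
    _ ≤ (G.neighborFinset v).card * ∑ u ∈ G.neighborFinset v, ‖f v - f u‖ ^ 2 :=
      sq_sum_le_card_mul_sum_sq
    _ ≤ D * ∑ u ∈ G.neighborFinset v, ‖f v - f u‖ ^ 2 := by
      refine mul_le_mul_of_nonneg_right ?_ (Finset.sum_nonneg fun _ _ => sq_nonneg _)
      rw [G.card_neighborFinset_eq_degree]
      exact_mod_cast hD v

theorem summable_sq_lapl_iterate {D : ℕ} (hD : ∀ v, G.degree v ≤ D) (k : ℕ) {f : V → ℂ}
    (hf : Summable fun v => ‖f v‖ ^ 2) : Summable fun v => ‖(lapl G)^[k] f v‖ ^ 2 := by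
  induction k with
  | zero => exact hf
  | succ k ih =>
    rw [Function.iterate_succ_apply']
    exact summable_sq_lapl G hD ih

/-- Green's formula for the combinatorial Laplacian. -/
theorem two_mul_tsum_lapl_mul_conj {D : ℕ} (hD : ∀ v, G.degree v ≤ D) {f g : V → ℂ}
    (hf : Summable fun v => ‖f v‖ ^ 2) (hg : Summable fun v => ‖g v‖ ^ 2) :
    2 * ∑' v, lapl G f v * (starRingEnd ℂ) (g v) = ∑' p : V × V, (adjPairs G).indicator
      (fun p => (f p.1 - f p.2) * (starRingEnd ℂ) (g p.1 - g p.2)) p := by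
  have hQ := summable_adjPairs_sq_sub G hD hf
  have h1 := summable_indicator_fst G hD (P := G.Adj) (fun _ _ h => h) hg (fun v => sq_nonneg _)
  have hF : Summable ((adjPairs G).indicator
      fun p => (f p.1 - f p.2) * (starRingEnd ℂ) (g p.1)) := by
    refine Summable.of_norm_bounded (hQ.add h1) fun p => ?_
    by_cases hp : G.Adj p.1 p.2
    · simp only [adjPairs, Set.indicator, Set.mem_ofPred_eq, hp, if_true, norm_mul,
        RCLike.norm_conj]
      nlinarith [sq_nonneg (‖f p.1 - f p.2‖ - ‖g p.1‖), sq_nonneg (‖f p.1 - f p.2‖),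
        sq_nonneg (‖g p.1‖)]
    · simp [adjPairs, Set.indicator, hp]
  have hsum : ∑' v, lapl G f v * (starRingEnd ℂ) (g v) = ∑' p : V × V, (adjPairs G).indicator
      (fun p => (f p.1 - f p.2) * (starRingEnd ℂ) (g p.1)) p := by
    rw [hF.tsum_prod]
    simp_rw [tsum_indicator_adjPairs, ← Finset.sum_mul]
    rfl
  rw [hsum, two_mul]
  nth_rewrite 2 [← (Equiv.prodComm V V).tsum_eq]
  refine (Summable.tsum_add hF ((Equiv.prodComm V V).summable_iff.2 hF)).symm.trans ?_
  refine tsum_congr fun p => ?_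
  by_cases hp : G.Adj p.1 p.2
  · simp only [adjPairs, Set.indicator, Function.comp_apply, Set.mem_ofPred_eq, hp, hp.symm, if_true,
      Equiv.prodComm_apply, Prod.fst_swap, Prod.snd_swap, map_sub]
    ring
  · have hp' : ¬ G.Adj p.2 p.1 := fun h => hp h.symm
    simp [adjPairs, Set.indicator, hp, hp']

theorem tsum_lapl_mul_conj_comm {D : ℕ} (hD : ∀ v, G.degree v ≤ D) {f g : V → ℂ}
    (hf : Summable fun v => ‖f v‖ ^ 2) (hg : Summable fun v => ‖g v‖ ^ 2) :
    ∑' v, lapl G f v * (starRingEnd ℂ) (g v) = ∑' v, f v * (starRingEnd ℂ) (lapl G g v) := by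
  have h1 := two_mul_tsum_lapl_mul_conj G hD hf hg
  have h2 := congrArg (starRingEnd ℂ) (two_mul_tsum_lapl_mul_conj G hD hg hf)
  rw [map_mul, Complex.conj_tsum, Complex.conj_tsum] at h2
  have h3 : (starRingEnd ℂ) 2 = 2 := Complex.conj_ofNat 2
  rw [h3] at h2
  refine mul_left_cancel₀ (two_ne_zero (α := ℂ)) ?_
  rw [h1]
  simp only [map_mul, Complex.conj_conj] at h2
  simp_rw [mul_comm (f _)]
  rw [h2]
  refine tsum_congr fun p => ?_
  by_cases hp : p ∈ adjPairs G
  · simp [hp, mul_comm]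
  · simp [hp]

theorem tsum_lapl_iterate_mul_conj {D : ℕ} (hD : ∀ v, G.degree v ≤ D) (k : ℕ) {f g : V → ℂ}
    (hf : Summable fun v => ‖f v‖ ^ 2) (hg : Summable fun v => ‖g v‖ ^ 2) :
    ∑' v, (lapl G)^[k] f v * (starRingEnd ℂ) (g v)
      = ∑' v, f v * (starRingEnd ℂ) ((lapl G)^[k] g v) := by
  induction k generalizing g with
  | zero => rfl
  | succ k ih =>
    rw [Function.iterate_succ_apply',
      tsum_lapl_mul_conj_comm G hD (summable_sq_lapl_iterate G hD k hf) hg,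
      ih (summable_sq_lapl G hD hg), Function.iterate_succ_apply]

theorem dirichletPow_one {D : ℕ} (hD : ∀ v, G.degree v ≤ D) {f : V → ℂ}
    (hf : Summable fun v => ‖f v‖ ^ 2) :
    2 * dirichletPow G f 1
      = ∑' p : V × V, (adjPairs G).indicator (fun p => ‖f p.1 - f p.2‖ ^ 2) p := by
  have h := congrArg Complex.re (two_mul_tsum_lapl_mul_conj G hD hf hf)
  have h2 : ∀ p : V × V, (adjPairs G).indicator
      (fun p => (f p.1 - f p.2) * (starRingEnd ℂ) (f p.1 - f p.2)) p
      = (((adjPairs G).indicator (fun p => ‖f p.1 - f p.2‖ ^ 2) p : ℝ) : ℂ) := by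
    intro p
    by_cases hp : p ∈ adjPairs G
    · rw [Set.indicator_of_mem hp, Set.indicator_of_mem hp, Complex.mul_conj']
      push_cast
      rfl
    · simp [hp]
  simp_rw [h2] at h
  rw [← Complex.ofReal_tsum, Complex.ofReal_re] at h
  rw [← h]
  simp [dirichletPow]

theorem dirichletPow_two_mul {D : ℕ} (hD : ∀ v, G.degree v ≤ D) (k : ℕ) {f : V → ℂ}
    (hf : Summable fun v => ‖f v‖ ^ 2) :
    dirichletPow G f (2 * k) = ∑' v, ‖(lapl G)^[k] f v‖ ^ 2 := by
  rw [dirichletPow, two_mul]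
  simp_rw [Function.iterate_add_apply]
  rw [tsum_lapl_iterate_mul_conj G hD k (summable_sq_lapl_iterate G hD k hf) hf]
  simp_rw [Complex.mul_conj']
  rw [← Complex.ofReal_re (∑' v, ‖(lapl G)^[k] f v‖ ^ 2), Complex.ofReal_tsum]
  push_cast
  rfl

theorem sq_re_tsum_mul_conj_le {f g : V → ℂ}
    (hf : Summable fun v => ‖f v‖ ^ 2) (hg : Summable fun v => ‖g v‖ ^ 2) :
    (∑' v, f v * (starRingEnd ℂ) (g v)).re ^ 2 ≤ (∑' v, ‖f v‖ ^ 2) * ∑' v, ‖g v‖ ^ 2 := by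
  have hfg := Real.summable_and_inner_le_Lp_mul_Lq_tsum_of_nonneg
    Real.HolderConjugate.two_two (f := fun v => ‖f v‖) (g := fun v => ‖g v‖)
    (fun _ => norm_nonneg _) (fun _ => norm_nonneg _) (by simpa using hf) (by simpa using hg)
  obtain ⟨hs, hle⟩ := hfg
  have hF0 : 0 ≤ ∑' v, ‖f v‖ ^ 2 := tsum_nonneg fun _ => sq_nonneg _
  have hG0 : 0 ≤ ∑' v, ‖g v‖ ^ 2 := tsum_nonneg fun _ => sq_nonneg _
  simp only [Real.rpow_ofNat, ← Real.sqrt_eq_rpow] at hle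
  have hnorm : ‖∑' v, f v * (starRingEnd ℂ) (g v)‖ ≤ ∑' v, ‖f v‖ * ‖g v‖ := by
    refine (norm_tsum_le_tsum_norm (by simpa using hs)).trans_eq ?_
    simp
  have habs := (Complex.abs_re_le_norm _).trans (hnorm.trans hle)
  rw [← sq_abs]
  calc _ ≤ _ := pow_le_pow_left₀ (abs_nonneg _) habs 2
    _ = _ := by rw [mul_pow, Real.sq_sqrt hF0, Real.sq_sqrt hG0]

theorem dirichletPow_two_pow_nonneg {D : ℕ} (hD : ∀ v, G.degree v ≤ D) (l : ℕ) {f : V → ℂ}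
    (hf : Summable fun v => ‖f v‖ ^ 2) : 0 ≤ dirichletPow G f (2 ^ l) := by
  cases l with
  | zero =>
    have h := dirichletPow_one G hD hf
    have h0 : 0 ≤ ∑' p : V × V, (adjPairs G).indicator (fun p => ‖f p.1 - f p.2‖ ^ 2) p :=
      tsum_nonneg fun p => Set.indicator_nonneg (fun _ _ => sq_nonneg _) p
    rw [pow_zero]
    linarith
  | succ l =>
    rw [pow_succ', dirichletPow_two_mul G hD _ hf]
    exact tsum_nonneg fun _ => sq_nonneg _

/-- Interpolation between `‖f‖` and `‖L^{r/2} f‖` for `r = 2 ^ l`. -/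
theorem dirichletPow_one_pow_le {D : ℕ} (hD : ∀ v, G.degree v ≤ D) (l : ℕ) {f : V → ℂ}
    (hf : Summable fun v => ‖f v‖ ^ 2) :
    dirichletPow G f 1 ^ 2 ^ l
      ≤ dirichletPow G f (2 ^ l) * (∑' v, ‖f v‖ ^ 2) ^ (2 ^ l - 1) := by
  have hN : 0 ≤ ∑' v, ‖f v‖ ^ 2 := tsum_nonneg fun _ => sq_nonneg _
  induction l with
  | zero => simp
  | succ l ih =>
    have h1 : 0 ≤ dirichletPow G f 1 := by simpa using dirichletPow_two_pow_nonneg G hD 0 hf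
    have h2 : dirichletPow G f (2 ^ l) ^ 2
        ≤ dirichletPow G f (2 ^ (l + 1)) * ∑' v, ‖f v‖ ^ 2 := by
      rw [pow_succ' 2 l, dirichletPow_two_mul G hD _ hf]
      exact sq_re_tsum_mul_conj_le (summable_sq_lapl_iterate G hD _ hf) hf
    have hexp : 2 ^ (l + 1) - 1 = (2 ^ l - 1) * 2 + 1 := by
      have : 1 ≤ 2 ^ l := Nat.one_le_two_pow
      omega
    calc dirichletPow G f 1 ^ 2 ^ (l + 1) = (dirichletPow G f 1 ^ 2 ^ l) ^ 2 := by
          rw [← pow_mul, ← pow_succ]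
      _ ≤ (dirichletPow G f (2 ^ l) * (∑' v, ‖f v‖ ^ 2) ^ (2 ^ l - 1)) ^ 2 :=
          pow_le_pow_left₀ (pow_nonneg h1 _) ih 2
      _ = dirichletPow G f (2 ^ l) ^ 2 * (∑' v, ‖f v‖ ^ 2) ^ ((2 ^ l - 1) * 2) := by
          rw [mul_pow, ← pow_mul]
      _ ≤ dirichletPow G f (2 ^ (l + 1)) * (∑' v, ‖f v‖ ^ 2)
            * (∑' v, ‖f v‖ ^ 2) ^ ((2 ^ l - 1) * 2) :=
          mul_le_mul_of_nonneg_right h2 (pow_nonneg hN _)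
      _ = _ := by rw [hexp, pow_succ]; ring

end Laplacian

section Closure

theorem Km_le_ncard (G : SimpleGraph V) (S : Set V) (m : ℕ) {v : V} (hv : v ∈ bdry G ((cl G)^[m] S)) :
    Km G S m ≤ {w | w ∈ (cl G)^[m] S ∧ G.Adj v w}.ncard :=
  Nat.sInf_le (Set.mem_image_of_mem _ hv)

variable (G : SimpleGraph V) [G.LocallyFinite]

theorem ncard_le_Dm {D : ℕ} (hD : ∀ v, G.degree v ≤ D) (S : Set V) (m : ℕ) {v : V}
    (hv : v ∈ (cl G)^[m] S) :
    {w | w ∈ bdry G ((cl G)^[m] S) ∧ G.Adj v w}.ncard ≤ Dm G S m := by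
  refine le_csSup ⟨D, ?_⟩ (Set.mem_image_of_mem _ hv)
  rintro _ ⟨u, -, rfl⟩
  exact ncard_le_of_imp_adj G hD
    (P := fun v w => w ∈ bdry G ((cl G)^[m] S) ∧ G.Adj v w) (fun _ _ h => h.2) u

theorem Km_pos (S : Set V) (m : ℕ) (hb : (bdry G ((cl G)^[m] S)).Nonempty) : 0 < Km G S m := by
  obtain ⟨v, hv, hvK⟩ := Nat.sInf_mem (hb.image
    (fun v => {w | w ∈ (cl G)^[m] S ∧ G.Adj v w}.ncard))
  rw [Km, ← hvK]
  obtain ⟨-, u, hu, huv⟩ := hv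
  exact (Set.ncard_pos (finite_setOf_of_imp_adj G
    (P := fun v w => w ∈ (cl G)^[m] S ∧ G.Adj v w) (fun _ _ h => h.2) v)).2 ⟨u, hu, huv.symm⟩

theorem Km_mul_tsum_bdry_le {D : ℕ} (hD : ∀ v, G.degree v ≤ D) (S : Set V) (m : ℕ) {f : V → ℂ}
    (hf : Summable fun v => ‖f v‖ ^ 2) :
    (Km G S m : ℝ) * ∑' v, (bdry G ((cl G)^[m] S)).indicator (fun v => ‖f v‖ ^ 2) v
      ≤ 2 * (Dm G S m : ℝ) * ∑' v, ((cl G)^[m] S).indicator (fun v => ‖f v‖ ^ 2) v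
        + 2 * ∑' p : V × V, (adjPairs G).indicator (fun p => ‖f p.1 - f p.2‖ ^ 2) p := by
  set C := (cl G)^[m] S
  let P : V → V → Prop := fun v u => v ∈ bdry G C ∧ u ∈ C ∧ G.Adj v u
  have hP : ∀ v u, P v u → G.Adj v u := fun v u h => h.2.2
  have hP' : ∀ u v, P v u → G.Adj u v := fun u v h => h.2.2.symm
  have hf0 : ∀ v, 0 ≤ ‖f v‖ ^ 2 := fun v => sq_nonneg _
  have hQ := summable_adjPairs_sq_sub G hD hf
  have hfst := summable_indicator_fst G hD hP hf hf0
  have hsnd := summable_indicator_snd G hD hP hf hf0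
  have hlower : (Km G S m : ℝ) * ∑' v, (bdry G C).indicator (fun v => ‖f v‖ ^ 2) v
      ≤ ∑' p : V × V, {p : V × V | P p.1 p.2}.indicator (fun p => ‖f p.1‖ ^ 2) p := by
    rw [tsum_prod_indicator_fst G hD hP hf hf0, ← tsum_mul_left]
    refine Summable.tsum_le_tsum (fun v => ?_) ((hf.indicator _).mul_left _)
      (summable_ncard_mul G hD hP hf hf0)
    by_cases hv : v ∈ bdry G C
    · rw [Set.indicator_of_mem hv]
      refine mul_le_mul_of_nonneg_right ?_ (hf0 v)
      have h := Km_le_ncard G S m hv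
      simpa [P, hv] using h
    · rw [Set.indicator_of_notMem hv, mul_zero]
      exact mul_nonneg (Nat.cast_nonneg _) (hf0 v)
  have hupper : ∑' p : V × V, {p : V × V | P p.1 p.2}.indicator (fun p => ‖f p.2‖ ^ 2) p
      ≤ (Dm G S m : ℝ) * ∑' v, C.indicator (fun v => ‖f v‖ ^ 2) v := by
    rw [tsum_prod_indicator_snd G hD hP hf hf0, ← tsum_mul_left]
    refine Summable.tsum_le_tsum (fun v => ?_) (summable_ncard_mul G hD hP' hf hf0)
      ((hf.indicator _).mul_left _)
    by_cases hv : v ∈ C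
    · rw [Set.indicator_of_mem hv]
      refine mul_le_mul_of_nonneg_right ?_ (hf0 v)
      have h := ncard_le_Dm G hD S m hv
      simpa [P, hv, G.adj_comm v] using h
    · simp [P, hv]
  have hmid : ∑' p : V × V, {p : V × V | P p.1 p.2}.indicator (fun p => ‖f p.1‖ ^ 2) p
      ≤ 2 * ∑' p : V × V, {p : V × V | P p.1 p.2}.indicator (fun p => ‖f p.2‖ ^ 2) p
        + 2 * ∑' p : V × V, (adjPairs G).indicator (fun p => ‖f p.1 - f p.2‖ ^ 2) p := by
    rw [← tsum_mul_left, ← tsum_mul_left,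
      ← Summable.tsum_add (hsnd.mul_left 2) (hQ.mul_left 2)]
    refine Summable.tsum_le_tsum (fun p => ?_) hfst ((hsnd.mul_left 2).add (hQ.mul_left 2))
    by_cases hp : P p.1 p.2
    · rw [Set.indicator_of_mem (s := {p : V × V | P p.1 p.2}) hp,
        Set.indicator_of_mem (s := {p : V × V | P p.1 p.2}) hp,
        Set.indicator_of_mem (s := adjPairs G) (hP _ _ hp)]
      exact sq_norm_le_add_sub _ _
    · rw [Set.indicator_of_notMem (s := {p : V × V | P p.1 p.2}) hp,
        Set.indicator_of_notMem (s := {p : V × V | P p.1 p.2}) hp, mul_zero, zero_add]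
      exact mul_nonneg zero_le_two (Set.indicator_nonneg (fun _ _ => sq_nonneg _) p)
  linarith

theorem tsum_cl_succ_le {D : ℕ} (hD : ∀ v, G.degree v ≤ D) (S : Set V) (m : ℕ) {f : V → ℂ}
    (hf : Summable fun v => ‖f v‖ ^ 2) :
    ∑' v, ((cl G)^[m + 1] S).indicator (fun v => ‖f v‖ ^ 2) v
      ≤ (2 * (Dm G S m : ℝ) / (Km G S m : ℝ) + 1)
          * ∑' v, ((cl G)^[m] S).indicator (fun v => ‖f v‖ ^ 2) v
        + 1 / (Km G S m : ℝ)
          * (2 * ∑' p : V × V, (adjPairs G).indicator (fun p => ‖f p.1 - f p.2‖ ^ 2) p) := by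
  have h := Km_mul_tsum_bdry_le G hD S m hf
  have hsplit : ∑' v, ((cl G)^[m + 1] S).indicator (fun v => ‖f v‖ ^ 2) v
      = ∑' v, ((cl G)^[m] S).indicator (fun v => ‖f v‖ ^ 2) v
        + ∑' v, (bdry G ((cl G)^[m] S)).indicator (fun v => ‖f v‖ ^ 2) v := by
    rw [Function.iterate_succ_apply', cl, Set.indicator_union_of_disjoint]
    · exact Summable.tsum_add (hf.indicator _) (hf.indicator _)
    · exact Set.disjoint_right.2 fun v hv => hv.1
  rw [hsplit]
  have hs0 : 0 ≤ ∑' v, ((cl G)^[m] S).indicator (fun v => ‖f v‖ ^ 2) v :=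
    tsum_nonneg fun v => Set.indicator_nonneg (fun _ _ => sq_nonneg _) v
  have hQ0 : 0 ≤ ∑' p : V × V, (adjPairs G).indicator (fun p => ‖f p.1 - f p.2‖ ^ 2) p :=
    tsum_nonneg fun p => Set.indicator_nonneg (fun _ _ => sq_nonneg _) p
  rcases (bdry G ((cl G)^[m] S)).eq_empty_or_nonempty with hb | hb
  · rw [hb, Set.indicator_empty, tsum_zero, add_zero, add_mul, one_mul]
    have : 0 ≤ 2 * (Dm G S m : ℝ) / (Km G S m : ℝ)
        * ∑' v, ((cl G)^[m] S).indicator (fun v => ‖f v‖ ^ 2) v := by positivity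
    have : 0 ≤ 1 / (Km G S m : ℝ)
        * (2 * ∑' p : V × V, (adjPairs G).indicator (fun p => ‖f p.1 - f p.2‖ ^ 2) p) := by
      positivity
    linarith
  · have hK : (0 : ℝ) < Km G S m := by exact_mod_cast Km_pos G S m hb
    rw [mul_comm, ← le_div_iff₀ hK] at h
    refine (add_le_add_right h _).trans_eq ?_
    field_simp
    ring

theorem tsum_cl_iterate_le {D : ℕ} (hD : ∀ v, G.degree v ≤ D) (S : Set V) (n : ℕ) {f : V → ℂ}
    (hf : Summable fun v => ‖f v‖ ^ 2) :
    ∑' v, ((cl G)^[n] S).indicator (fun v => ‖f v‖ ^ 2) v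
      ≤ (∏ i ∈ Finset.range n, (2 * (Dm G S i : ℝ) / (Km G S i : ℝ) + 1))
          * ∑' v, S.indicator (fun v => ‖f v‖ ^ 2) v
        + (∑ j ∈ Finset.range n, (1 / (Km G S j : ℝ)) *
            ∏ i ∈ Finset.Ico (j + 1) n, (2 * (Dm G S i : ℝ) / (Km G S i : ℝ) + 1))
          * (2 * ∑' p : V × V, (adjPairs G).indicator (fun p => ‖f p.1 - f p.2‖ ^ 2) p) := by
  induction n with
  | zero => simp
  | succ n ih =>
    have hα : 0 ≤ 2 * (Dm G S n : ℝ) / (Km G S n : ℝ) + 1 := by positivity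
    have hsum : ∑ j ∈ Finset.range n, (1 / (Km G S j : ℝ)) *
          ∏ i ∈ Finset.Ico (j + 1) (n + 1), (2 * (Dm G S i : ℝ) / (Km G S i : ℝ) + 1)
        = (∑ j ∈ Finset.range n, (1 / (Km G S j : ℝ)) *
          ∏ i ∈ Finset.Ico (j + 1) n, (2 * (Dm G S i : ℝ) / (Km G S i : ℝ) + 1))
          * (2 * (Dm G S n : ℝ) / (Km G S n : ℝ) + 1) := by
      rw [Finset.sum_mul]
      refine Finset.sum_congr rfl fun j hj => ?_
      rw [Finset.prod_Ico_succ_top (Finset.mem_range.1 hj), mul_assoc]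
    rw [Finset.prod_range_succ, Finset.sum_range_succ, hsum, Finset.Ico_self, Finset.prod_empty,
      mul_one]
    refine (tsum_cl_succ_le G hD S n hf).trans ?_
    refine (add_le_add_left (mul_le_mul_of_nonneg_left ih hα) _).trans_eq ?_
    ring

end Closure

theorem le_natCast_mul_add_of_pow_le {x p q y : ℝ} {r : ℕ} (hr : 1 ≤ r) (hx : 0 ≤ x) (hp : 0 ≤ p)
    (hq : 0 ≤ q) (hy : 0 ≤ y) (hxpq : x ≤ p + q) (hqr : q ^ r ≤ y * x ^ (r - 1)) :
    x ≤ r * p + y := by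
  rcases hx.eq_or_lt with rfl | hx
  · positivity
  have hB := one_add_mul_le_pow (a := q / x - 1) (by linarith [div_nonneg hq hx.le]) r
  rw [add_sub_cancel, div_pow] at hB
  have h1 : q ^ r / x ^ r ≤ y / x := by
    rw [div_le_div_iff₀ (pow_pos hx _) hx]
    calc q ^ r * x ≤ y * x ^ (r - 1) * x := mul_le_mul_of_nonneg_right hqr hx.le
      _ = y * x ^ r := by rw [mul_assoc, ← pow_succ, Nat.sub_add_cancel hr]
  have h2 := hB.trans h1
  rw [le_div_iff₀ hx] at h2
  have h3 : (1 + (r : ℝ) * (q / x - 1)) * x = x + r * (q - x) := by field_simp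
  rw [h3] at h2
  nlinarith [mul_nonneg (Nat.cast_nonneg (α := ℝ) r) (sub_nonneg.2 hxpq)]

theorem sqrt_add_le_add_sqrt {a b : ℝ} (ha : 0 ≤ a) (hb : 0 ≤ b) : √(a + b) ≤ √a + √b := by
  rw [Real.sqrt_le_left (by positivity), add_sq, Real.sq_sqrt ha, Real.sq_sqrt hb]
  have : 0 ≤ 2 * √a * √b := by positivity
  linarith

theorem sqrt_pow_of_nonneg {a : ℝ} (ha : 0 ≤ a) (k : ℕ) : √(a ^ k) = √a ^ k := by
  rw [Real.sqrt_eq_iff_eq_sq (by positivity) (by positivity), pow_right_comm, Real.sq_sqrt ha]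

theorem stmt6 [Countable V] (G : SimpleGraph V) [DecidableRel G.Adj] [G.LocallyFinite]
    (hconn : G.Connected) (D : ℕ) (hD : ∀ v, G.degree v ≤ D)
    (S : Set V) (n : ℕ) (hn : 1 ≤ n)
    (hcover : (cl G)^[n] S = Set.univ)
    (l : ℕ) (hl : 1 ≤ l) (r : ℕ) (hr : r = 2 ^ l)
    (f : V → ℂ) (hf : Memℓp f 2) :
    l2norm f ≤
      2 * (r : ℝ) * Real.sqrt (∏ i ∈ Finset.range n, (2 * (Dm G S i : ℝ) / (Km G S i : ℝ) + 1)) *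
        Real.sqrt (∑' v : S, ‖f v‖ ^ 2)
      + (2 : ℝ) ^ (4 * r - 3 : ℕ) *
          (∑ j ∈ Finset.range n, (1 / (Km G S j : ℝ)) *
            ∏ i ∈ Finset.Ico (j + 1) n, (2 * (Dm G S i : ℝ) / (Km G S i : ℝ) + 1)) ^ ((r : ℝ) / 2) *
          Real.sqrt (dirichletPow G f r) := by
  have hfs : Summable fun v => ‖f v‖ ^ 2 := by
    simpa using (memℓp_gen_iff (by norm_num)).1 hf
  have hr1 : 1 ≤ r := hr ▸ Nat.one_le_two_pow
  have hmain := tsum_cl_iterate_le G hD S n hfs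
  rw [hcover, Set.indicator_univ, ← dirichletPow_one G hD hfs] at hmain
  have hinterp := dirichletPow_one_pow_le G hD l hfs
  have ha1 : 0 ≤ dirichletPow G f 1 := by simpa using dirichletPow_two_pow_nonneg G hD 0 hfs
  have har := dirichletPow_two_pow_nonneg G hD l hfs
  rw [← hr] at hinterp har
  rw [l2norm, tsum_subtype S fun v => ‖f v‖ ^ 2]
  set A := ∏ i ∈ Finset.range n, (2 * (Dm G S i : ℝ) / (Km G S i : ℝ) + 1)
  set B := ∑ j ∈ Finset.range n, (1 / (Km G S j : ℝ)) *
    ∏ i ∈ Finset.Ico (j + 1) n, (2 * (Dm G S i : ℝ) / (Km G S i : ℝ) + 1)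
  set N := ∑' v, ‖f v‖ ^ 2
  set s := ∑' v, S.indicator (fun v => ‖f v‖ ^ 2) v
  have hA : 0 ≤ A := Finset.prod_nonneg fun i _ => by positivity
  have hB : 0 ≤ B := Finset.sum_nonneg fun j _ => by positivity
  have hN : 0 ≤ N := tsum_nonneg fun _ => sq_nonneg _
  have hs : 0 ≤ s := tsum_nonneg fun v => Set.indicator_nonneg (fun _ _ => sq_nonneg _) v
  have hsqrt : √N ≤ √(A * s) + √(4 * B * dirichletPow G f 1) := by
    refine (Real.sqrt_le_sqrt (hmain.trans_eq ?_)).trans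
      (sqrt_add_le_add_sqrt (by positivity) (by positivity))
    ring
  have hpow : √(4 * B * dirichletPow G f 1) ^ r
      ≤ √((4 * B) ^ r * dirichletPow G f r) * √N ^ (r - 1) := by
    rw [← sqrt_pow_of_nonneg (by positivity), ← sqrt_pow_of_nonneg hN, ← Real.sqrt_mul (by positivity)]
    refine Real.sqrt_le_sqrt ?_
    rw [mul_pow, mul_assoc]
    gcongr
  refine (le_natCast_mul_add_of_pow_le hr1 (Real.sqrt_nonneg _) (Real.sqrt_nonneg _)
    (Real.sqrt_nonneg _) (Real.sqrt_nonneg _) hsqrt hpow).trans (add_le_add ?_ ?_)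
  · rw [Real.sqrt_mul hA, mul_assoc]
    have : 0 ≤ (r : ℝ) * (√A * √s) := by positivity
    linarith
  · have hfour : √((4 : ℝ) ^ r) = 2 ^ r := by
      rw [show (4 : ℝ) = 2 ^ 2 by norm_num, ← pow_mul, mul_comm, pow_mul,
        Real.sqrt_sq (by positivity)]
    have hBr : √(B ^ r) = B ^ ((r : ℝ) / 2) := by
      rw [Real.sqrt_eq_rpow, ← Real.rpow_natCast, ← Real.rpow_mul hB]
      ring_nf
    rw [Real.sqrt_mul (by positivity), mul_pow, Real.sqrt_mul (by positivity), hfour, hBr]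
    gcongr
    · norm_num
    · omega
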